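/- Let A be an associative algebra over a field and let U be an ideal of the Lie algebra A^(-). Then the two-sided associative ideal of A generated by [U,U] equals [U,U] + [U,U]A, i.e., id_A([U,U]) = [U,U] + [U,U]A as subspaces of A. -/

import Mathlib

/-- The linear span of all commutators `u * v - v * u` with `u ∈ U`, `v ∈ V`. -/
def commSpan (F : Type*) [Field F] {A : Type*} [NonUnitalRing A] [Module F A]
    [SMulCommClass F A A] [IsScalarTower F A A] (U V : Submodule F A) : Submodule F A :=
  Submodule.span F {x | ∃ u ∈ U, ∃ v ∈ V, x = u * v - v * u}

/-- The linear span of all products `u * v` with `u ∈ U`, `v ∈ V`. -/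
def mulSpan (F : Type*) [Field F] {A : Type*} [NonUnitalRing A] [Module F A]
    [SMulCommClass F A A] [IsScalarTower F A A] (U V : Submodule F A) : Submodule F A :=
  Submodule.span F {x | ∃ u ∈ U, ∃ v ∈ V, x = u * v}

/-- The two-sided associative ideal of `A` generated by a set `S`. -/
def algIdealGen (F : Type*) [Field F] {A : Type*} [NonUnitalRing A] [Module F A]
    [SMulCommClass F A A] [IsScalarTower F A A] (S : Set A) : Submodule F A :=
  sInf {p : Submodule F A | S ⊆ ↑p ∧ ∀ a : A, ∀ x ∈ p, a * x ∈ p ∧ x * a ∈ p}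

section

variable {F A : Type*} [Field F] [NonUnitalRing A] [Module F A] [SMulCommClass F A A]
  [IsScalarTower F A A]

theorem mul_mem_mulSpan {U V : Submodule F A} {u v : A} (hu : u ∈ U) (hv : v ∈ V) :
    u * v ∈ mulSpan F U V :=
  Submodule.subset_span ⟨u, hu, v, hv, rfl⟩

theorem mul_sub_mul_mem_commSpan {U V : Submodule F A} {u v : A} (hu : u ∈ U) (hv : v ∈ V) :
    u * v - v * u ∈ commSpan F U V :=
  Submodule.subset_span ⟨u, hu, v, hv, rfl⟩

/-- If `U` and `V` are Lie ideals of `A⁽⁻⁾`, then so is `[U, V]`. -/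
theorem commSpan_lie_mem {U V : Submodule F A} (hU : ∀ u ∈ U, ∀ a : A, u * a - a * u ∈ U)
    (hV : ∀ v ∈ V, ∀ a : A, v * a - a * v ∈ V) {c : A} (hc : c ∈ commSpan F U V) (a : A) :
    c * a - a * c ∈ commSpan F U V := by
  induction hc using Submodule.span_induction with
  | mem x hx =>
    obtain ⟨u, hu, v, hv, rfl⟩ := hx
    have jacobi : (u * v - v * u) * a - a * (u * v - v * u) =
        ((u * a - a * u) * v - v * (u * a - a * u)) +
          (u * (v * a - a * v) - (v * a - a * v) * u) := by
      noncomm_ring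
    rw [jacobi]
    exact add_mem (mul_sub_mul_mem_commSpan (hU u hu a) hv)
      (mul_sub_mul_mem_commSpan hu (hV v hv a))
  | zero => simp
  | add x y _ _ hx hy =>
    have split : (x + y) * a - a * (x + y) = (x * a - a * x) + (y * a - a * y) := by
      noncomm_ring
    rw [split]
    exact add_mem hx hy
  | smul r x _ hx =>
    rw [smul_mul_assoc, mul_smul_comm, ← smul_sub]
    exact Submodule.smul_mem _ r hx

/-- The associative ideal generated by a Lie ideal `L` of `A⁽⁻⁾` is `L + LA`. -/
theorem algIdealGen_eq_sup_mulSpan_top (L : Submodule F A)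
    (hL : ∀ c ∈ L, ∀ a : A, c * a - a * c ∈ L) :
    algIdealGen F (L : Set A) = L ⊔ mulSpan F L ⊤ := by
  apply le_antisymm
  · refine sInf_le ⟨fun x hx => Submodule.mem_sup_left hx, fun a x hx => ?_⟩
    obtain ⟨c, hc, d, hd, rfl⟩ := Submodule.mem_sup.1 hx
    rw [mul_add, add_mul]
    have hd' : a * d ∈ mulSpan F L ⊤ ∧ d * a ∈ mulSpan F L ⊤ := by
      clear hx
      induction hd using Submodule.span_induction with
      | mem x hx =>
        obtain ⟨u, hu, v, -, rfl⟩ := hx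
        refine ⟨?_, ?_⟩
        · have expand : a * (u * v) = u * (a * v) - (u * a - a * u) * v := by noncomm_ring
          rw [expand]
          exact sub_mem (mul_mem_mulSpan hu trivial) (mul_mem_mulSpan (hL u hu a) trivial)
        · rw [mul_assoc]
          exact mul_mem_mulSpan hu trivial
      | zero => simp
      | add x y _ _ hx hy =>
        rw [mul_add, add_mul]
        exact ⟨add_mem hx.1 hy.1, add_mem hx.2 hy.2⟩
      | smul r x _ hx =>
        rw [mul_smul_comm, smul_mul_assoc]
        exact ⟨Submodule.smul_mem _ r hx.1, Submodule.smul_mem _ r hx.2⟩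
    have hca : c * a ∈ L ⊔ mulSpan F L ⊤ :=
      Submodule.mem_sup_right (mul_mem_mulSpan hc trivial)
    refine ⟨add_mem ?_ (Submodule.mem_sup_right hd'.1),
      add_mem hca (Submodule.mem_sup_right hd'.2)⟩
    rw [← sub_sub_cancel (c * a) (a * c)]
    exact sub_mem hca (Submodule.mem_sup_left (hL c hc a))
  · refine le_sInf fun p hp => sup_le hp.1 (Submodule.span_le.2 ?_)
    rintro _ ⟨u, hu, v, -, rfl⟩
    exact (hp.2 v u (hp.1 hu)).2

end

/-- Let `A` be an associative algebra over a field and `U` an ideal of the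
Lie algebra `A⁽⁻⁾`.  Then `id_A([U,U]) = [U,U] + [U,U]A`. -/
theorem idealGen_comm_eq
    (F : Type*) [Field F]
    (A : Type*) [NonUnitalRing A] [Module F A] [SMulCommClass F A A] [IsScalarTower F A A]
    (U : Submodule F A) (hU : ∀ u ∈ U, ∀ a : A, u * a - a * u ∈ U) :
    algIdealGen F (commSpan F U U : Set A) =
      commSpan F U U ⊔ mulSpan F (commSpan F U U) ⊤ := by
  exact algIdealGen_eq_sup_mulSpan_top _ fun _ hc a => commSpan_lie_mem hU hU hc a
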